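/- arXiv:2004.05154 — 2 statements merged into one kernel-verified Lean document; each statement's English description precedes it below -/
import Mathlib

section
/- (Kondor–Trivedi) Let G be a finite group with subgroups H_i and H_o. Let V_i = {f : G → ℂ | f(g h) = f(g) for all g ∈ G, h ∈ H_i} and V_o = {f : G → ℂ | f(g h) = f(g) for all g ∈ G, h ∈ H_o} (functions on the homogeneous spaces G/H_i and G/H_o). For u ∈ G let λ_u act by (λ_u f)(g) = f(u⁻¹ g); λ_u preserves both V_i and V_o. Then a ℂ-linear map Φ : V_i → V_o satisfies Φ ∘ λ_u = λ_u ∘ Φ for all u ∈ G if and only if there exists k : G → ℂ with k(h_i g h_o) = k(g) for all g ∈ G, h_i ∈ H_i, h_o ∈ H_o (i.e. k is a function on the double coset space H_i\G/H_o), such that (Φ f)(g) = Σ_{u ∈ G} f(g u⁻¹) k(u) for all f ∈ V_i and g ∈ G. That is, a linear map between feature spaces on homogeneous spaces of G is G-equivariant if and only if it is a group convolution with some filter on H_i\G/H_o. -/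
/-- The space of right `H`-invariant functions `G → ℂ`, i.e. the functions on the left coset
space `G/H`, as a submodule of `G → ℂ`. -/
noncomputable def rightInvariant {G : Type*} [Group G] (H : Subgroup G) : Submodule ℂ (G → ℂ) where
  carrier := {f | ∀ (g h : G), h ∈ H → f (g * h) = f g}
  add_mem' := by
    intro a b ha hb g h hh
    simp only [Pi.add_apply, ha g h hh, hb g h hh]
  zero_mem' := by
    intro g h hh
    rfl
  smul_mem' := by
    intro c a ha g h hh
    simp only [Pi.smul_apply, ha g h hh]

/-- Left translation preserves right `H`-invariance. -/
theorem lam_mem {G : Type*} [Group G] {H : Subgroup G} {f : G → ℂ}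
    (hf : f ∈ rightInvariant H) (u : G) :
    (fun g => f (u⁻¹ * g)) ∈ rightInvariant H := by
  intro g h hh
  simpa [mul_assoc] using hf (u⁻¹ * g) h hh

/-- **Kondor–Trivedi theorem (finite case).**
`G` is a finite group with subgroups `H_i`, `H_o`; `V_i`, `V_o` are the spaces of right
invariant functions (functions on `G/H_i`, `G/H_o`). A `ℂ`-linear map `Φ : V_i → V_o`
commutes with all left translations `λ_u` if and only if there is a filter
`k : H_i\G/H_o → ℂ` (i.e. `k(h_i g h_o) = k(g)`) with
`(Φ f)(g) = Σ_{u ∈ G} f(g u⁻¹) k(u)`, i.e. `Φ` is a group convolution. -/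
theorem stmt_7 {G : Type*} [Group G] [Fintype G] (Hi Ho : Subgroup G)
    (Φ : rightInvariant (G := G) Hi →ₗ[ℂ] rightInvariant (G := G) Ho) :
    (∀ (u : G) (f : rightInvariant (G := G) Hi),
        (↑(Φ ⟨fun g => (f : G → ℂ) (u⁻¹ * g), lam_mem f.2 u⟩) : G → ℂ)
          = fun g => (↑(Φ f) : G → ℂ) (u⁻¹ * g)) ↔
    (∃ k : G → ℂ,
        (∀ (g hi ho : G), hi ∈ Hi → ho ∈ Ho → k (hi * g * ho) = k g) ∧
        (∀ (f : rightInvariant (G := G) Hi) (g : G),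
          (↑(Φ f) : G → ℂ) g = ∑ u : G, (f : G → ℂ) (g * u⁻¹) * k u)) := by
  classical
  constructor
  · intro hΦ
    have he : (fun g : G => if g ∈ Hi then (1 : ℂ) else 0) ∈ rightInvariant Hi := by
      intro g h hh
      simp only [Subgroup.mul_mem_cancel_right Hi hh]
    set e : rightInvariant (G := G) Hi := ⟨_, he⟩ with hedef
    have he1 : ∀ g, (e : G → ℂ) g = if g ∈ Hi then (1 : ℂ) else 0 := fun g => rfl
    set N : ℂ := ∑ y : G, (e : G → ℂ) y with hN
    have hN0 : N ≠ 0 := by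
      rw [hN]
      simp only [he1, Finset.sum_boole]
      rw [Nat.cast_ne_zero]
      exact Finset.card_ne_zero.mpr ⟨1, by simp [Hi.one_mem]⟩
    refine ⟨fun g => N⁻¹ * (Φ e : G → ℂ) g, ?_, ?_⟩
    · intro g hi ho hhi hho
      have h1 : (Φ e : G → ℂ) (hi * g * ho) = (Φ e : G → ℂ) (hi * g) :=
        (Φ e).2 (hi * g) ho hho
      have h2 := congrFun (hΦ hi⁻¹ e) g
      have h3 : (⟨fun g => (e : G → ℂ) ((hi⁻¹)⁻¹ * g), lam_mem e.2 hi⁻¹⟩ :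
          rightInvariant (G := G) Hi) = e := by
        apply Subtype.ext
        funext x
        simp only [he1, inv_inv, Subgroup.mul_mem_cancel_left Hi hhi]
      rw [h3] at h2
      simp only [inv_inv] at h2
      simp only [h1, ← h2]
    · intro f g
      have hf : f = N⁻¹ • ∑ x : G, (f : G → ℂ) x •
          (⟨fun g => (e : G → ℂ) (x⁻¹ * g), lam_mem e.2 x⟩ : rightInvariant (G := G) Hi) := by
        apply Subtype.ext
        funext y
        simp only [Submodule.coe_smul, Submodule.coe_sum, Pi.smul_apply, Finset.sum_apply,
          smul_eq_mul]
        have h1 : ∀ x : G, (f : G → ℂ) x * (e : G → ℂ) (x⁻¹ * y)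
            = (f : G → ℂ) y * (e : G → ℂ) (x⁻¹ * y) := by
          intro x
          by_cases h : x⁻¹ * y ∈ Hi
          · have := f.2 x _ h
            rw [mul_inv_cancel_left] at this
            rw [this]
          · simp [he1, h]
        have h2 : ∑ x : G, (e : G → ℂ) (x⁻¹ * y) = N :=
          Fintype.sum_equiv ((Equiv.inv G).trans (Equiv.mulRight y)) _ _ (fun x => rfl)
        rw [Finset.sum_congr rfl (fun x _ => h1 x), ← Finset.mul_sum, h2]
        field_simp
      have h4 : (Φ f : G → ℂ) g
          = N⁻¹ * ∑ x : G, (f : G → ℂ) x * (Φ e : G → ℂ) (x⁻¹ * g) := by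
        conv_lhs => rw [hf]
        simp only [map_smul, map_sum, Submodule.coe_smul, Submodule.coe_sum, Pi.smul_apply,
          Finset.sum_apply, smul_eq_mul, hΦ]
      rw [h4, Finset.mul_sum]
      refine Fintype.sum_equiv ((Equiv.inv G).trans (Equiv.mulRight g)) _ _ (fun x => ?_)
      simp
      ring
  · rintro ⟨k, -, hk⟩ u f
    funext g
    rw [hk, hk]
    simp only [mul_assoc]
end

section
/- (Equivariance of 3D steerable CNNs) Let SO(3) be the group of real 3 × 3 orthogonal matrices with determinant 1, acting on ℝ³ by matrix–vector multiplication, and let ρ_i : SO(3) → GL(ℂ^{d_i}) and ρ_o : SO(3) → GL(ℂ^{d_o}) be group homomorphisms (given by invertible complex matrices). Let κ : ℝ³ → M_{d_o × d_i}(ℂ) be continuous with compact support and satisfy the kernel constraint κ(r x) = ρ_o(r) · κ(x) · ρ_i(r)⁻¹ for all r ∈ SO(3) and x ∈ ℝ³. For a translation t ∈ ℝ³ and rotation r ∈ SO(3), define the induced SE(3)-actions (π_i(r, t) f)(x) = ρ_i(r) · f(r⁻¹(x − t)) on continuous bounded f : ℝ³ → ℂ^{d_i}, and similarly π_o on ℂ^{d_o}-valued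 functions. Define the cross-correlation (κ ⋆ f)(x) = ∫_{ℝ³} κ(y − x) · f(y) dy with respect to Lebesgue measure. Then the cross-correlation is SE(3)-equivariant: κ ⋆ (π_i(r, t) f) = π_o(r, t)(κ ⋆ f) for all r ∈ SO(3), t ∈ ℝ³. -/
open MeasureTheory Matrix

/-- The special orthogonal group `SO(3)`: real `3 × 3` orthogonal matrices of determinant 1,
as the kernel of the determinant on the orthogonal group. -/
noncomputable def SO3 : Subgroup (Matrix.orthogonalGroup (Fin 3) ℝ) :=
  MonoidHom.ker (Matrix.detMonoidHom.comp (Matrix.unitaryGroup (Fin 3) ℝ).subtype)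

/-- **SE(3)-equivariance of 3D steerable CNNs.**
`ρ_i, ρ_o` are matrix representations of `SO(3)`, and the kernel
`κ : ℝ³ → M_{d_o × d_i}(ℂ)` is continuous, compactly supported, and satisfies
`κ(r x) = ρ_o(r) κ(x) ρ_i(r)⁻¹`. Then for continuous bounded fields `f : ℝ³ → ℂ^{d_i}`,
the cross-correlation `(κ ⋆ f)(x) = ∫_{ℝ³} κ(y − x) f(y) dy` intertwines the induced
`SE(3)`-actions: `κ ⋆ (π_i(r, t) f) = π_o(r, t)(κ ⋆ f)`, where
`(π(r, t) f)(x) = ρ(r) f(r⁻¹(x − t))`. -/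
theorem stmt_15 {di dout : ℕ}
    (ρi : SO3 →* Matrix.GeneralLinearGroup (Fin di) ℂ)
    (ρo : SO3 →* Matrix.GeneralLinearGroup (Fin dout) ℂ)
    (κ : (Fin 3 → ℝ) → Matrix (Fin dout) (Fin di) ℂ)
    (hκc : Continuous κ) (hκs : HasCompactSupport κ)
    (hκ : ∀ (r : SO3) (x : Fin 3 → ℝ),
        κ (r.1.1 *ᵥ x)
          = (ρo r : Matrix (Fin dout) (Fin dout) ℂ) * κ x *
              (((ρi r)⁻¹ : Matrix.GeneralLinearGroup (Fin di) ℂ) :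
                Matrix (Fin di) (Fin di) ℂ))
    (f : (Fin 3 → ℝ) → (Fin di → ℂ)) (hf : Continuous f)
    (hfb : ∃ C, ∀ x, ‖f x‖ ≤ C)
    (r : SO3) (t : Fin 3 → ℝ) (x : Fin 3 → ℝ) :
    (∫ y, κ (y - x) *ᵥ ((ρi r : Matrix (Fin di) (Fin di) ℂ) *ᵥ f (r⁻¹.1.1 *ᵥ (y - t))))
      = (ρo r : Matrix (Fin dout) (Fin dout) ℂ) *ᵥ
          (∫ y, κ (y - r⁻¹.1.1 *ᵥ (x - t)) *ᵥ f y) := by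
  have hdet : ((r⁻¹).1.1 : Matrix (Fin 3) (Fin 3) ℝ).det = 1 := by
    have h := (r⁻¹).2
    exact h
  have hrr : (r.1.1 : Matrix (Fin 3) (Fin 3) ℝ) * (r⁻¹).1.1 = 1 := by
    have h : r * r⁻¹ = 1 := mul_inv_cancel r
    exact congrArg (fun s : SO3 => (s.1.1 : Matrix (Fin 3) (Fin 3) ℝ)) h
  generalize hA : ((r⁻¹).1.1 : Matrix (Fin 3) (Fin 3) ℝ) = A at *
  set g : (Fin 3 → ℝ) → (Fin dout → ℂ) := fun y => κ (y - A *ᵥ (x - t)) *ᵥ f y with hg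
  have hgc : Continuous g :=
    (hκc.comp (continuous_id.sub continuous_const)).matrix_mulVec hf
  have hgs : HasCompactSupport g := by
    have h1 : HasCompactSupport (fun y => κ (y - A *ᵥ (x - t))) :=
      hκs.comp_homeomorph (Homeomorph.subRight (A *ᵥ (x - t)))
    refine h1.mono ?_
    intro y hy hz
    apply hy
    have hz' : κ (y - A *ᵥ (x - t)) = 0 := hz
    simp [hg, hz']
  have hgi : Integrable g := hgc.integrable_of_hasCompactSupport hgs
  have hmp : (volume : Measure (Fin 3 → ℝ)).map (Matrix.toLin' A) = volume := by
    rw [Real.map_matrix_volume_pi_eq_smul_volume_pi (by rw [hdet]; exact one_ne_zero), hdet]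
    simp
  have hcv : ∫ y, g (A *ᵥ (y - t)) = ∫ y, g y := by
    rw [integral_sub_right_eq_self (fun y => g (A *ᵥ y)) t]
    conv_rhs => rw [← hmp]
    rw [integral_map]
    · simp only [Matrix.toLin'_apply]
    · exact (LinearMap.continuous_of_finiteDimensional _).aemeasurable
    · exact hgc.aestronglyMeasurable
  have hmv : (ρo r : Matrix (Fin dout) (Fin dout) ℂ) *ᵥ (∫ y, g (A *ᵥ (y - t)))
      = ∫ y, (ρo r : Matrix (Fin dout) (Fin dout) ℂ) *ᵥ g (A *ᵥ (y - t)) := by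
    have hgi' : Integrable (fun y => g (A *ᵥ (y - t))) := by
      have h2 : Integrable (fun y => g (A *ᵥ y)) := by
        have h3 : Integrable g ((volume : Measure (Fin 3 → ℝ)).map (Matrix.toLin' A)) := by
          rw [hmp]; exact hgi
        exact h3.comp_aemeasurable
          (LinearMap.continuous_of_finiteDimensional _).aemeasurable
      exact h2.comp_sub_right t
    exact ((LinearMap.toContinuousLinearMap
      (Matrix.toLin' (ρo r : Matrix (Fin dout) (Fin dout) ℂ))).integral_comp_comm hgi').symm
  rw [← hcv, hmv]
  congr 1
  funext y
  have hk := hκ r (A *ᵥ (y - x))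
  rw [Matrix.mulVec_mulVec, hrr, Matrix.one_mulVec] at hk
  have hsub : A *ᵥ (y - t) - A *ᵥ (x - t) = A *ᵥ (y - x) := by
    rw [← Matrix.mulVec_sub]; congr 1; abel
  have hinv : (((ρi r)⁻¹ : Matrix.GeneralLinearGroup (Fin di) ℂ) : Matrix (Fin di) (Fin di) ℂ)
      * (ρi r : Matrix (Fin di) (Fin di) ℂ) = 1 := Units.inv_mul _
  simp only [hg]
  rw [hsub, hk, Matrix.mulVec_mulVec, Matrix.mulVec_mulVec, Matrix.mul_assoc, hinv,
    Matrix.mul_one]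
end
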